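/- arXiv:2604.04899 — 5 statements merged into one kernel-verified Lean document; each statement's English description precedes it below -/
import Mathlib

section
/- Let K₁,…,K_m be 2×2 complex matrices with Σᵢ Kᵢ†Kᵢ = I₂ and Σᵢ KᵢKᵢ† = I₂, and let Φ(A) = Σᵢ Kᵢ†AKᵢ be the dual map. If the channel is EBI-contextuality-breaking (for every 4×4 positive semidefinite ρ with tr ρ = 1, every triple A₁,A₂,A₃ of sharp qubit observables, and every quadruple B₁,…,B₄ of 2×2 Hermitian involutions: Re tr[ρ·(Φ(A₁)⊗(B₁+B₂−B₃−B₄) + Φ(A₂)⊗(B₁−B₂+B₃−B₄) + Φ(A₃)⊗(B₁−B₂−B₃+B₄))] ≤ 4), then it is CHSH-nonlocality-breaking: for every 4×4 positive semidefinite ρ with tr ρ = 1, every pair A₁,A₂ of sharp qubit observables and every pair B₁,B₂ of 2×2 Hermitian matrices with B_y² = I₂, one has Re tr[ρ·(Φ(A₁)⊗(B₁+B₂) + Φ(A₂)⊗(B₁−B₂))] ≤ 2. -/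
open Matrix Kronecker
open scoped ComplexOrder

/-- A sharp qubit observable: a 2×2 Hermitian matrix with zero trace squaring to `I₂`. -/
def SharpQubitObservable (A : Matrix (Fin 2) (Fin 2) ℂ) : Prop :=
  A.IsHermitian ∧ A.trace = 0 ∧ A * A = 1

/-- The Heisenberg (dual) map of a Kraus channel. -/
noncomputable def dualMap {m : ℕ} (K : Fin m → Matrix (Fin 2) (Fin 2) ℂ)
    (A : Matrix (Fin 2) (Fin 2) ℂ) : Matrix (Fin 2) (Fin 2) ℂ :=
  ∑ i, (K i)ᴴ * A * K i

/-- If a unital qubit channel is EBI-contextuality-breaking, then it is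
CHSH-nonlocality-breaking. -/
theorem EBI_CBC_implies_CHSH_NBC {m : ℕ} (K : Fin m → Matrix (Fin 2) (Fin 2) ℂ)
    (hTP : ∑ i, (K i)ᴴ * K i = 1) (hUnital : ∑ i, K i * (K i)ᴴ = 1)
    (hEBI : ∀ ρ : Matrix (Fin 2 × Fin 2) (Fin 2 × Fin 2) ℂ, ρ.PosSemidef → ρ.trace = 1 →
      ∀ A : Fin 3 → Matrix (Fin 2) (Fin 2) ℂ, (∀ x, SharpQubitObservable (A x)) →
      ∀ B : Fin 4 → Matrix (Fin 2) (Fin 2) ℂ,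
        (∀ y, (B y).IsHermitian ∧ B y * B y = 1) →
        ((ρ * (dualMap K (A 0) ⊗ₖ (B 0 + B 1 - B 2 - B 3)
             + dualMap K (A 1) ⊗ₖ (B 0 - B 1 + B 2 - B 3)
             + dualMap K (A 2) ⊗ₖ (B 0 - B 1 - B 2 + B 3))).trace).re ≤ 4) :
    ∀ ρ : Matrix (Fin 2 × Fin 2) (Fin 2 × Fin 2) ℂ, ρ.PosSemidef → ρ.trace = 1 →
      ∀ A : Fin 2 → Matrix (Fin 2) (Fin 2) ℂ, (∀ x, SharpQubitObservable (A x)) →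
      ∀ B : Fin 2 → Matrix (Fin 2) (Fin 2) ℂ,
        (∀ y, (B y).IsHermitian ∧ B y * B y = 1) →
        ((ρ * (dualMap K (A 0) ⊗ₖ (B 0 + B 1)
             + dualMap K (A 1) ⊗ₖ (B 0 - B 1))).trace).re ≤ 2 := by
  intro ρ hρ htr A hA B hB
  have h := hEBI ρ hρ htr ![A 0, A 1, A 1]
    (by intro x; fin_cases x <;> simp [hA]) ![B 0, B 1, -B 1, -B 0]
    (by
      intro y
      fin_cases y
      · exact hB 0
      · exact hB 1
      · exact ⟨(hB 1).1.neg, by simpa using (hB 1).2⟩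
      · exact ⟨(hB 0).1.neg, by simpa using (hB 0).2⟩)
  simp only [Matrix.cons_val] at h
  have h₁ : B 0 + B 1 - -B 1 - -B 0 = (2 : ℂ) • (B 0 + B 1) := by module
  have h₂ : B 0 - B 1 + -B 1 - -B 0 = (2 : ℂ) • (B 0 - B 1) := by module
  have h₃ : B 0 - B 1 - -B 1 + -B 0 = 0 := by abel
  rw [h₁, h₂, h₃, kronecker_zero, add_zero, kronecker_smul, kronecker_smul, ← smul_add,
    mul_smul_comm, trace_smul, smul_eq_mul, Complex.mul_re, Complex.re_ofNat,
    Complex.im_ofNat, zero_mul, sub_zero] at h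
  linarith
end

section
/- For every real p with 1/√3 < p ≤ 1/√2, the qubit depolarizing channel with parameter p, whose dual acts as Φₚ(A) = pA + (1−p)·tr(A)·I₂/2, is CHSH-nonlocality-breaking but not EBI-contextuality-breaking. Precisely: (i) for every 4×4 positive semidefinite matrix ρ with tr ρ = 1, every pair A₁,A₂ of sharp qubit observables and every pair B₁,B₂ of 2×2 Hermitian matrices with B_y² = I₂, Re tr[ρ·(Φₚ(A₁)⊗(B₁+B₂) + Φₚ(A₂)⊗(B₁−B₂))] ≤ 2; and (ii) Re tr[(p·ρ_AB + (1−p)·I₄/4)·𝔅] = 4√3·p > 4. -/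
open Matrix Kronecker
open scoped ComplexOrder

noncomputable def σx : Matrix (Fin 2) (Fin 2) ℂ := !![0, 1; 1, 0]
noncomputable def σy : Matrix (Fin 2) (Fin 2) ℂ := !![0, -Complex.I; Complex.I, 0]
noncomputable def σz : Matrix (Fin 2) (Fin 2) ℂ := !![1, 0; 0, -1]

/-- Bob's observables for the Elegant Bell inequality. -/
noncomputable def B1 : Matrix (Fin 2) (Fin 2) ℂ := (Real.sqrt 3 : ℂ)⁻¹ • (σx - σy + σz)
noncomputable def B2 : Matrix (Fin 2) (Fin 2) ℂ := (Real.sqrt 3 : ℂ)⁻¹ • (σx + σy - σz)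
noncomputable def B3 : Matrix (Fin 2) (Fin 2) ℂ := (Real.sqrt 3 : ℂ)⁻¹ • (-σx - σy - σz)
noncomputable def B4 : Matrix (Fin 2) (Fin 2) ℂ := (Real.sqrt 3 : ℂ)⁻¹ • (-σx + σy + σz)

/-- The EBI Bell operator 𝔅 with Alice's observables A₁ = σx, A₂ = σy, A₃ = σz. -/
noncomputable def EBIop : Matrix (Fin 2 × Fin 2) (Fin 2 × Fin 2) ℂ :=
  σx ⊗ₖ (B1 + B2 - B3 - B4) + σy ⊗ₖ (B1 - B2 + B3 - B4) + σz ⊗ₖ (B1 - B2 - B3 + B4)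

/-- The maximally entangled two-qubit state. -/
noncomputable def ρAB : Matrix (Fin 2 × Fin 2) (Fin 2 × Fin 2) ℂ :=
  (4 : ℂ)⁻¹ • ((1 : Matrix (Fin 2) (Fin 2) ℂ) ⊗ₖ (1 : Matrix (Fin 2) (Fin 2) ℂ)
    + σx ⊗ₖ σx - σy ⊗ₖ σy + σz ⊗ₖ σz)

/-- The dual (Heisenberg) map of the qubit depolarizing channel with parameter `p`. -/
noncomputable def depolDual (p : ℝ) (A : Matrix (Fin 2) (Fin 2) ℂ) :
    Matrix (Fin 2) (Fin 2) ℂ :=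
  (p : ℂ) • A + ((1 - p : ℝ) : ℂ) • A.trace • ((2 : ℂ)⁻¹ • (1 : Matrix (Fin 2) (Fin 2) ℂ))

open scoped MatrixOrder

theorem depolDual_of_sharp (p : ℝ) {A : Matrix (Fin 2) (Fin 2) ℂ}
    (hA : SharpQubitObservable A) : depolDual p A = (p : ℂ) • A := by
  simp [depolDual, hA.2.1]

/-- The trace of a product of two positive semidefinite matrices has nonnegative real part. -/
theorem Matrix.PosSemidef.re_trace_mul_nonneg {n : Type*} [Fintype n] [DecidableEq n]
    {M N : Matrix n n ℂ} (hM : M.PosSemidef) (hN : N.PosSemidef) : 0 ≤ (M * N).trace.re := by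
  obtain ⟨C, rfl⟩ := CStarAlgebra.nonneg_iff_eq_star_mul_self.mp hN.nonneg
  rw [← Matrix.mul_assoc, Matrix.trace_mul_comm, ← Matrix.mul_assoc]
  exact (Complex.le_def.mp (hM.mul_mul_conjTranspose_same C).trace_nonneg).1

/-- Local `±1`-valued observables on two systems form a CHSH tuple. -/
theorem isCHSHTuple_kronecker {m n : Type*} [Fintype m] [DecidableEq m] [Fintype n]
    [DecidableEq n] {A₀ A₁ : Matrix m m ℂ} {B₀ B₁ : Matrix n n ℂ}
    (hA₀ : A₀.IsHermitian ∧ A₀ * A₀ = 1) (hA₁ : A₁.IsHermitian ∧ A₁ * A₁ = 1)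
    (hB₀ : B₀.IsHermitian ∧ B₀ * B₀ = 1) (hB₁ : B₁.IsHermitian ∧ B₁ * B₁ = 1) :
    IsCHSHTuple (A₀ ⊗ₖ (1 : Matrix n n ℂ)) (A₁ ⊗ₖ (1 : Matrix n n ℂ))
      ((1 : Matrix m m ℂ) ⊗ₖ B₀) ((1 : Matrix m m ℂ) ⊗ₖ B₁) := by
  constructor <;>
    simp [pow_two, ← Matrix.mul_kronecker_mul, Matrix.star_eq_conjTranspose,
      Matrix.conjTranspose_kronecker, hA₀.1.eq, hA₁.1.eq, hB₀.1.eq, hB₁.1.eq,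
      hA₀.2, hA₁.2, hB₀.2, hB₁.2]

instance Matrix.isOrderedModule_real {n : Type*} [Fintype n] :
    IsOrderedModule ℝ (Matrix n n ℂ) :=
  .of_smul_nonneg fun _ hr _ hM => (hM.posSemidef.smul hr).nonneg

/-- Tsirelson's bound for the expectation of the CHSH operator in a bipartite state. -/
theorem re_trace_mul_CHSH_le {m n : Type*} [Fintype m] [DecidableEq m] [Fintype n]
    [DecidableEq n] {ρ : Matrix (m × n) (m × n) ℂ} (hρ : ρ.PosSemidef) (htr : ρ.trace = 1)
    {A₀ A₁ : Matrix m m ℂ} {B₀ B₁ : Matrix n n ℂ}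
    (hA₀ : A₀.IsHermitian ∧ A₀ * A₀ = 1) (hA₁ : A₁.IsHermitian ∧ A₁ * A₁ = 1)
    (hB₀ : B₀.IsHermitian ∧ B₀ * B₀ = 1) (hB₁ : B₁.IsHermitian ∧ B₁ * B₁ = 1) :
    (ρ * (A₀ ⊗ₖ (B₀ + B₁) + A₁ ⊗ₖ (B₀ - B₁))).trace.re ≤ √2 ^ 3 := by
  have h := tsirelson_inequality _ _ _ _ (isCHSHTuple_kronecker hA₀ hA₁ hB₀ hB₁)
  simp only [← Matrix.mul_kronecker_mul, Matrix.mul_one, Matrix.one_mul, add_sub_assoc] at h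
  have h' := hρ.re_trace_mul_nonneg (Matrix.le_iff.mp h)
  rw [Matrix.mul_sub, Matrix.mul_smul, Matrix.mul_one, Matrix.trace_sub, Matrix.trace_smul, htr,
    Complex.sub_re, Complex.smul_re, Complex.one_re, smul_eq_mul, mul_one, sub_nonneg] at h'
  have hsub : A₁ ⊗ₖ (B₀ - B₁) = A₁ ⊗ₖ B₀ - A₁ ⊗ₖ B₁ := by
    ext; simp [mul_sub]
  rwa [Matrix.kronecker_add, hsub]

theorem EBIop_eq :
    EBIop = (4 * (Real.sqrt 3 : ℂ)⁻¹) • (σx ⊗ₖ σx - σy ⊗ₖ σy + σz ⊗ₖ σz) := by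
  have hx : B1 + B2 - B3 - B4 = (4 * (Real.sqrt 3 : ℂ)⁻¹) • σx := by
    simp only [B1, B2, B3, B4]; module
  have hy : B1 - B2 + B3 - B4 = (-(4 * (Real.sqrt 3 : ℂ)⁻¹)) • σy := by
    simp only [B1, B2, B3, B4]; module
  have hz : B1 - B2 - B3 + B4 = (4 * (Real.sqrt 3 : ℂ)⁻¹) • σz := by
    simp only [B1, B2, B3, B4]; module
  rw [EBIop, hx, hy, hz]
  simp only [Matrix.kronecker_smul]
  module

theorem trace_EBIop : EBIop.trace = 0 := by
  simp [EBIop_eq, Matrix.trace_kronecker, σx, σy, σz, Matrix.trace_fin_two]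

theorem trace_ρAB_mul_EBIop : (ρAB * EBIop).trace = 12 * (Real.sqrt 3 : ℂ)⁻¹ := by
  rw [EBIop_eq, ρAB]
  simp [add_mul, sub_mul, mul_add, mul_sub, ← Matrix.mul_kronecker_mul, Matrix.trace_kronecker,
    σx, σy, σz, Matrix.trace_fin_two]
  ring

/-- For `1/√3 < p ≤ 1/√2`, the qubit depolarizing channel with parameter `p` is
CHSH-nonlocality-breaking but not EBI-contextuality-breaking. -/
theorem depol_CHSH_NBC_not_EBI_CBC (p : ℝ)
    (hlo : (Real.sqrt 3)⁻¹ < p) (hhi : p ≤ (Real.sqrt 2)⁻¹) :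
    (∀ ρ : Matrix (Fin 2 × Fin 2) (Fin 2 × Fin 2) ℂ, ρ.PosSemidef → ρ.trace = 1 →
      ∀ A : Fin 2 → Matrix (Fin 2) (Fin 2) ℂ, (∀ x, SharpQubitObservable (A x)) →
      ∀ B : Fin 2 → Matrix (Fin 2) (Fin 2) ℂ,
        (∀ y, (B y).IsHermitian ∧ B y * B y = 1) →
        ((ρ * (depolDual p (A 0) ⊗ₖ (B 0 + B 1)
             + depolDual p (A 1) ⊗ₖ (B 0 - B 1))).trace).re ≤ 2) ∧
    ((((p : ℂ) • ρAB + ((1 - p : ℝ) : ℂ) •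
        ((4 : ℂ)⁻¹ • (1 : Matrix (Fin 2 × Fin 2) (Fin 2 × Fin 2) ℂ))) * EBIop).trace).re
      = 4 * Real.sqrt 3 * p ∧
    4 < 4 * Real.sqrt 3 * p := by
  have h3 : 0 < √3 := by positivity
  have h2 : 0 < √2 := by positivity
  have h33 : √3 * √3 = 3 := Real.mul_self_sqrt (by norm_num)
  have h22 : √2 * √2 = 2 := Real.mul_self_sqrt (by norm_num)
  have hp : 0 < p := (inv_pos.mpr h3).trans hlo
  refine ⟨fun ρ hρ htr A hA B hB => ?_, ?_, ?_⟩
  · have h := re_trace_mul_CHSH_le hρ htr ⟨(hA 0).1, (hA 0).2.2⟩ ⟨(hA 1).1, (hA 1).2.2⟩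
      (hB 0) (hB 1)
    rw [depolDual_of_sharp p (hA 0), depolDual_of_sharp p (hA 1), Matrix.smul_kronecker,
      Matrix.smul_kronecker, ← smul_add, Matrix.mul_smul, Matrix.trace_smul, smul_eq_mul,
      Complex.re_ofReal_mul]
    calc p * _ ≤ p * √2 ^ 3 := by gcongr
      _ ≤ (√2)⁻¹ * √2 ^ 3 := by gcongr
      _ = 2 := by field_simp; linarith
  · have h : (12 * (Real.sqrt 3 : ℂ)⁻¹) = ((4 * √3 : ℝ) : ℂ) := by
      rw [← Complex.ofReal_inv, ← Complex.ofReal_ofNat, ← Complex.ofReal_mul]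
      congr 1
      field_simp
      linarith
    rw [Matrix.add_mul, Matrix.trace_add, Matrix.smul_mul, Matrix.smul_mul, Matrix.smul_mul,
      Matrix.one_mul, Matrix.trace_smul, Matrix.trace_smul, Matrix.trace_smul, trace_EBIop,
      trace_ρAB_mul_EBIop, h, smul_zero, smul_zero, add_zero, smul_eq_mul, ← Complex.ofReal_mul,
      Complex.ofReal_re, mul_comm]
  · have := (inv_lt_iff_one_lt_mul₀ h3).mp hlo
    linarith
end

section
/- For every real p ∈ [0,1], the amplitude-damping EBI-contextuality-breaking condition holds exactly on the stated interval: 4(2√p + p)/√3 ≤ 4 if and only if p ≤ (√(1+√3) − 1)² (numerically ≈ 0.4262). -/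
/-- The amplitude-damping EBI-contextuality-breaking condition
`4(2√p + p)/√3 ≤ 4` holds exactly when `p ≤ (√(1+√3) − 1)²`. -/
theorem AD_EBI_CBC_threshold (p : ℝ) (hp0 : 0 ≤ p) (hp1 : p ≤ 1) :
    4 * (2 * Real.sqrt p + p) / Real.sqrt 3 ≤ 4
      ↔ p ≤ (Real.sqrt (1 + Real.sqrt 3) - 1) ^ 2 := by
  have h3 : 0 < Real.sqrt 3 := by positivity
  have hr : 0 ≤ Real.sqrt (1 + Real.sqrt 3) - 1 :=
    sub_nonneg.2 (Real.one_le_sqrt.2 (by linarith))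
  have hs : Real.sqrt p ^ 2 = p := Real.sq_sqrt hp0
  rw [← Real.sqrt_le_left hr, le_sub_iff_add_le, Real.le_sqrt' (by positivity), div_le_iff₀ h3]
  constructor <;> intro h <;> nlinarith
end

section
/- Let N ≥ 1 and d ≥ 1, and let Ω₁,…,Ω_N be d×d Hermitian complex matrices satisfying the Clifford anticommutation relations ΩₓΩ_{x'} + Ω_{x'}Ωₓ = 2δ_{x,x'}·I_d for all x, x' (in particular Ωₓ² = I_d). Let p ≥ 0 with p·√N ≤ 1. Then the N binary POVMs Mₓ = {(I_d + pΩₓ)/2, (I_d − pΩₓ)/2}, x = 1,…,N, are jointly measurable: there exists G : {0,1}^N → d×d complex matrices such that every G(b) is positive semidefinite, Σ_b G(b) = I_d, and for each x and each a ∈ {0,1}, Σ_{b : bₓ = a} G(b) = (I_d + (−1)^a·p·Ωₓ)/2. (A witness is G(b) = 2^{−N}(I_d + p·Σₓ (−1)^{bₓ}Ωₓ).) -/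
open Matrix
open scoped ComplexOrder

/-- Joint measurability of a family of `n` binary POVMs on `d × d` matrices:
there is a global POVM `G` indexed by bit strings whose marginals reproduce
each of the given POVMs. -/
def JointlyMeasurable {n d : ℕ} (M : Fin n → Fin 2 → Matrix (Fin d) (Fin d) ℂ) : Prop :=
  ∃ G : (Fin n → Fin 2) → Matrix (Fin d) (Fin d) ℂ,
    (∀ b, (G b).PosSemidef) ∧
    (∑ b, G b) = 1 ∧
    (∀ x : Fin n, ∀ a : Fin 2,
      ∑ b ∈ Finset.univ.filter (fun b : Fin n → Fin 2 => b x = a), G b = M x a)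

theorem sum_sign_filter_ne {N : ℕ} {x y : Fin N} (hxy : y ≠ x) (a : Fin 2) :
    ∑ b ∈ Finset.univ.filter (fun b : Fin N → Fin 2 => b x = a), (-1 : ℂ) ^ (b y : ℕ) = 0 := by
  refine Finset.sum_involution (fun b _ => Function.update b y (1 - b y)) ?_ ?_ ?_ ?_
  · intro b _
    rcases Fin.exists_fin_two.mp ⟨b y, rfl⟩ with h | h <;> simp [h]
  · intro b _ _ h
    have := congrFun h y
    rcases Fin.exists_fin_two.mp ⟨b y, rfl⟩ with h | h <;> simp [h] at this
  · intro b hb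
    simpa [Function.update_of_ne hxy.symm] using hb
  · intro b _
    simp

theorem two_mul_card_filter_apply_eq {N : ℕ} (x : Fin N) (a : Fin 2) :
    2 * ((Finset.univ.filter (fun b : Fin N → Fin 2 => b x = a)).card : ℂ) = 2 ^ N := by
  have h := Fintype.card_filter_piFinset_const_eq_of_mem (Finset.univ : Finset (Fin 2)) x
    (Finset.mem_univ a)
  simp only [Fintype.piFinset_univ, Finset.card_univ, Fintype.card_fin] at h
  rw [h]
  have hN : N = N - 1 + 1 := by have := x.pos; omega
  conv_rhs => rw [hN, pow_succ]
  push_cast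
  ring

/-- A signed sum of anticommuting Hermitian unitaries squares to the number of summands. -/
theorem sq_sum_sign_smul {N d : ℕ} (Ω : Fin N → Matrix (Fin d) (Fin d) ℂ)
    (hCliff : ∀ x x', Ω x * Ω x' + Ω x' * Ω x
      = if x = x' then (2 : ℂ) • (1 : Matrix (Fin d) (Fin d) ℂ) else 0)
    (s : Fin N → ℂ) (hs : ∀ x, s x * s x = 1) :
    (∑ x, s x • Ω x) * (∑ x, s x • Ω x) = (N : ℂ) • (1 : Matrix (Fin d) (Fin d) ℂ) := by
  have h1 : (∑ x, s x • Ω x) * (∑ x, s x • Ω x)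
      = ∑ x, ∑ y, (s x * s y) • (Ω x * Ω y) := by
    simp only [Finset.sum_mul_sum, smul_mul_smul_comm]
  have h2 : (∑ x, s x • Ω x) * (∑ x, s x • Ω x)
      = ∑ x, ∑ y, (s x * s y) • (Ω y * Ω x) := by
    rw [h1, Finset.sum_comm]
    simp only [mul_comm]
  have h3 : (2 : ℂ) • ((∑ x, s x • Ω x) * (∑ x, s x • Ω x))
      = (2 : ℂ) • ((N : ℂ) • (1 : Matrix (Fin d) (Fin d) ℂ)) := by
    rw [two_smul]
    conv_lhs => rw [h1]
    conv_lhs => arg 2; rw [← h1, h2]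
    simp only [← Finset.sum_add_distrib, ← smul_add, hCliff]
    simp only [smul_ite, smul_zero, Finset.sum_ite_eq, Finset.mem_univ, if_true, hs, one_smul,
      Finset.sum_const, Finset.card_univ, Fintype.card_fin, ← Nat.cast_smul_eq_nsmul ℂ]
    rw [smul_comm]
  exact smul_right_injective _ (two_ne_zero) h3

theorem posSemidef_one_add_of_sq {d : ℕ} {A : Matrix (Fin d) (Fin d) ℂ} (hA : A.IsHermitian)
    {c : ℝ} (hc : c ≤ 1) (hsq : A * A = (c : ℂ) • (1 : Matrix (Fin d) (Fin d) ℂ)) :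
    (1 + A).PosSemidef := by
  have h : 1 + A = (2 : ℂ)⁻¹ • ((1 + A)ᴴ * (1 + A) + ((1 - c : ℝ) : ℂ) • 1) := by
    have hH : (1 + A)ᴴ = 1 + A := (Matrix.isHermitian_one.add hA)
    rw [hH, add_mul, mul_add, mul_add, hsq]
    simp only [mul_one, one_mul]
    push_cast
    module
  rw [h]
  refine ((posSemidef_conjTranspose_mul_self _).add (PosSemidef.one.smul ?_)).smul ?_
  · exact_mod_cast sub_nonneg.mpr hc
  · positivity

/-- For Hermitian matrices `Ω₁,…,Ω_N` satisfying the Clifford anticommutation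
relations and `0 ≤ p` with `p√N ≤ 1`, the `N` binary POVMs
`{(I + pΩₓ)/2, (I − pΩₓ)/2}` are jointly measurable. -/
theorem clifford_noisy_POVMs_jointly_measurable
    (N d : ℕ) (hN : 1 ≤ N) (hd : 1 ≤ d)
    (Ω : Fin N → Matrix (Fin d) (Fin d) ℂ)
    (hHerm : ∀ x, (Ω x).IsHermitian)
    (hCliff : ∀ x x', Ω x * Ω x' + Ω x' * Ω x
      = if x = x' then (2 : ℂ) • (1 : Matrix (Fin d) (Fin d) ℂ) else 0)
    (p : ℝ) (hp0 : 0 ≤ p) (hpN : p * Real.sqrt N ≤ 1) :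
    JointlyMeasurable (fun x (a : Fin 2) =>
      (2 : ℂ)⁻¹ • ((1 : Matrix (Fin d) (Fin d) ℂ)
        + ((-1 : ℂ) ^ (a : ℕ) * (p : ℂ)) • Ω x)) := by
  have hmarg : ∀ x : Fin N, ∀ a : Fin 2,
      ∑ b ∈ Finset.univ.filter (fun b : Fin N → Fin 2 => b x = a),
        ((2 : ℂ) ^ N)⁻¹ • (1 + (p : ℂ) • ∑ y, (-1 : ℂ) ^ (b y : ℕ) • Ω y)
      = (2 : ℂ)⁻¹ • ((1 : Matrix (Fin d) (Fin d) ℂ)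
        + ((-1 : ℂ) ^ (a : ℕ) * (p : ℂ)) • Ω x) := by
    intro x a
    have hcard := two_mul_card_filter_apply_eq x a
    have hsum : ∑ b ∈ Finset.univ.filter (fun b : Fin N → Fin 2 => b x = a),
        ∑ y, (-1 : ℂ) ^ (b y : ℕ) • Ω y
        = (((Finset.univ.filter (fun b : Fin N → Fin 2 => b x = a)).card : ℂ)
          * (-1 : ℂ) ^ (a : ℕ)) • Ω x := by
      rw [Finset.sum_comm]
      simp only [← Finset.sum_smul]
      rw [Finset.sum_eq_single x (fun y _ hy => by rw [sum_sign_filter_ne hy, zero_smul])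
        (by simp)]
      congr 1
      rw [Finset.sum_congr rfl (g := fun _ => (-1 : ℂ) ^ (a : ℕ))
        (fun b hb => by rw [(Finset.mem_filter.mp hb).2])]
      simp
    rw [← Finset.smul_sum, Finset.sum_add_distrib, ← Finset.smul_sum, hsum, Finset.sum_const,
      ← Nat.cast_smul_eq_nsmul ℂ, ← hcard]
    have hne : ((Finset.univ.filter (fun b : Fin N → Fin 2 => b x = a)).card : ℂ) ≠ 0 := by
      intro h
      rw [h, mul_zero] at hcard
      exact pow_ne_zero N two_ne_zero hcard.symm
    simp only [smul_add, smul_smul]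
    congr 2 <;> field_simp
  refine ⟨fun b => ((2 : ℂ) ^ N)⁻¹ • (1 + (p : ℂ) • ∑ y, (-1 : ℂ) ^ (b y : ℕ) • Ω y),
    fun b => ?_, ?_, hmarg⟩
  · refine PosSemidef.smul ?_ (by positivity)
    refine posSemidef_one_add_of_sq (c := p ^ 2 * N) ?_ ?_ ?_
    · simp [IsHermitian, conjTranspose_sum, conjTranspose_smul, (hHerm _).eq]
    · have := pow_le_one₀ (n := 2) (by positivity) hpN
      rwa [mul_pow, Real.sq_sqrt (Nat.cast_nonneg N)] at this
    · rw [smul_mul_smul_comm, sq_sum_sign_smul Ω hCliff _ (fun x => by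
        rw [← mul_pow]; simp), smul_smul]
      push_cast
      ring_nf
  · rw [← Finset.sum_fiberwise Finset.univ (fun b : Fin N → Fin 2 => b ⟨0, hN⟩)]
    simp only [hmarg, Fin.sum_univ_two]
    simp only [Fin.val_zero, Fin.val_one, pow_zero, pow_one]
    module
end

section
/- For every real p ∈ [0,1], the three binary qubit POVMs {(I₂ + pσx)/2, (I₂ − pσx)/2}, {(I₂ + pσy)/2, (I₂ − pσy)/2}, {(I₂ + pσz)/2, (I₂ − pσz)/2} are jointly measurable if and only if p ≤ 1/√3. Equivalently, the dual of the qubit depolarizing channel with parameter p breaks the triple-wise incompatibility of the three orthogonal sharp qubit observables σx, σy, σz exactly when p ≤ 1/√3. -/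
open Matrix
open scoped ComplexOrder

/-- The matrix with unit Bloch weight and Bloch vector `r`. -/
noncomputable def blochMatrix (r : Fin 3 → ℝ) : Matrix (Fin 2) (Fin 2) ℂ :=
  1 + ∑ x, (r x : ℂ) • ![σx, σy, σz] x

theorem blochMatrix_eq (r : Fin 3 → ℝ) :
    blochMatrix r = !![1 + (r 2 : ℂ), r 0 - r 1 * Complex.I; r 0 + r 1 * Complex.I, 1 - r 2] := by
  ext i j
  fin_cases i <;> fin_cases j <;>
    simp [blochMatrix, σx, σy, σz, Fin.sum_univ_three] <;> ring

theorem blochMatrix_isHermitian (r : Fin 3 → ℝ) : (blochMatrix r).IsHermitian := by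
  rw [blochMatrix_eq]
  ext i j
  fin_cases i <;> fin_cases j <;> simp [Complex.ext_iff]

/-- The Cayley-Hamilton relation for a Bloch matrix, solved for the matrix. -/
theorem blochMatrix_eq_half_sq_add (r : Fin 3 → ℝ) :
    blochMatrix r = (1 / 2 : ℝ) •
      ((blochMatrix r)ᴴ * blochMatrix r + (1 - ∑ x, r x ^ 2) • 1) := by
  rw [(blochMatrix_isHermitian r).eq, blochMatrix_eq]
  ext i j
  fin_cases i <;> fin_cases j <;>
    simp [Fin.sum_univ_three, Complex.ext_iff, pow_two] <;>
    constructor <;> ring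

theorem blochMatrix_posSemidef {r : Fin 3 → ℝ} (hr : ∑ x, r x ^ 2 ≤ 1) :
    (blochMatrix r).PosSemidef := by
  rw [blochMatrix_eq_half_sq_add]
  exact ((Matrix.posSemidef_conjTranspose_mul_self _).add
    (Matrix.PosSemidef.one.smul (sub_nonneg.2 hr))).smul (by norm_num)

open scoped MatrixOrder Matrix.Norms.L2Operator in
theorem Matrix.PosSemidef.trace_mul_nonneg {n : Type*} [Fintype n] [DecidableEq n]
    {A B : Matrix n n ℂ} (hA : A.PosSemidef) (hB : B.PosSemidef) : 0 ≤ (A * B).trace := by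
  obtain ⟨C, rfl⟩ := CStarAlgebra.nonneg_iff_eq_star_mul_self.1 hB.nonneg
  rw [Matrix.star_eq_conjTranspose, ← Matrix.mul_assoc, Matrix.trace_mul_comm, ← Matrix.mul_assoc]
  exact (hA.mul_mul_conjTranspose_same C).trace_nonneg

theorem trace_pauli_mul_self (x : Fin 3) :
    (![σx, σy, σz] x * ![σx, σy, σz] x).trace = 2 := by
  fin_cases x <;> simp [σx, σy, σz, Matrix.trace_fin_two] <;> norm_num

theorem sum_bits_three {α : Type*} [AddCommMonoid α] (f : (Fin 3 → Fin 2) → α) :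
    ∑ b, f b = ∑ i, ∑ j, ∑ k, f ![i, j, k] := by
  let e : Fin 2 × Fin 2 × Fin 2 ≃ (Fin 3 → Fin 2) :=
    { toFun := fun t => ![t.1, t.2.1, t.2.2]
      invFun := fun b => (b 0, b 1, b 2)
      left_inv := fun t => rfl
      right_inv := fun b => by ext i; fin_cases i <;> rfl }
  rw [← e.sum_comp, Fintype.sum_prod_type]
  simp only [Fintype.sum_prod_type]
  rfl

/-- Signed sums over a bit are differences of the two marginals. -/
theorem sum_sign_smul {n d : ℕ} (G : (Fin n → Fin 2) → Matrix (Fin d) (Fin d) ℂ) (x : Fin n) :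
    ∑ b, ((-1 : ℂ) ^ (b x : ℕ)) • G b =
      ∑ b ∈ Finset.univ.filter (fun b : Fin n → Fin 2 => b x = 0), G b -
        ∑ b ∈ Finset.univ.filter (fun b : Fin n → Fin 2 => b x = 1), G b := by
  rw [Finset.sum_filter, Finset.sum_filter, ← Finset.sum_sub_distrib]
  refine Finset.sum_congr rfl fun b _ => ?_
  generalize b x = a
  fin_cases a <;> simp

/-- The three noisy Pauli POVMs `{(I ± pσ)/2}` for `σ ∈ {σx, σy, σz}` are
jointly measurable if and only if `p ≤ 1/√3`. -/
theorem pauli_triple_jointly_measurable_iff (p : ℝ) (hp0 : 0 ≤ p) (hp1 : p ≤ 1) :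
    JointlyMeasurable (fun (x : Fin 3) (a : Fin 2) =>
      (2 : ℂ)⁻¹ • ((1 : Matrix (Fin 2) (Fin 2) ℂ)
        + ((-1 : ℂ) ^ (a : ℕ) * (p : ℂ)) • ![σx, σy, σz] x))
      ↔ p ≤ (Real.sqrt 3)⁻¹ := by
  have h3 : (0 : ℝ) < Real.sqrt 3 := by positivity
  have h3sq : Real.sqrt 3 ^ 2 = 3 := Real.sq_sqrt (by norm_num)
  constructor
  · rintro ⟨G, hG, hsum, hmarg⟩
    set c : ℝ := (Real.sqrt 3)⁻¹ with hc
    have hc0 : 0 < c := inv_pos.2 h3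
    have hcsq : 3 * c ^ 2 = 1 := by rw [hc, inv_pow, h3sq]; norm_num
    have hdiff (x : Fin 3) :
        ∑ b, ((-1 : ℂ) ^ (b x : ℕ)) • G b = (p : ℂ) • ![σx, σy, σz] x := by
      rw [sum_sign_smul, hmarg, hmarg, ← smul_sub, add_sub_add_left_eq_sub, ← sub_smul, smul_smul]
      congr 1
      simp
      ring
    let r (b : Fin 3 → Fin 2) (x : Fin 3) : ℝ := -(c * (-1) ^ (b x : ℕ))
    have hr (b : Fin 3 → Fin 2) : ∑ x, r b x ^ 2 ≤ 1 := by
      have h (x : Fin 3) : r b x ^ 2 = c ^ 2 := by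
        simp only [r, neg_sq, mul_pow]
        rw [← pow_mul, mul_comm _ 2, pow_mul]
        simp
      simp [h, hcsq]
    have hpos : 0 ≤ ∑ b, (G b * blochMatrix (r b)).trace :=
      Finset.sum_nonneg fun b _ => (hG b).trace_mul_nonneg (blochMatrix_posSemidef (hr b))
    have hval : ∑ b, (G b * blochMatrix (r b)).trace = ((2 - 6 * c * p : ℝ) : ℂ) := by
      have hterm (b : Fin 3 → Fin 2) : G b * blochMatrix (r b) = G b -
          ∑ x, (c : ℂ) • ((((-1 : ℂ) ^ (b x : ℕ)) • G b) * ![σx, σy, σz] x) := by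
        simp only [blochMatrix, r, Matrix.mul_add, Matrix.mul_one, Matrix.mul_sum, sub_eq_add_neg,
          ← Finset.sum_neg_distrib, Matrix.mul_smul, Matrix.smul_mul, smul_smul, ← neg_smul]
        push_cast
        rfl
      rw [← Matrix.trace_sum, Finset.sum_congr rfl fun b _ => hterm b, Finset.sum_sub_distrib,
        hsum, Finset.sum_comm]
      simp only [← Finset.smul_sum, ← Finset.sum_mul, hdiff]
      simp only [Matrix.trace_sub, Matrix.trace_sum,
        Matrix.trace_smul, Matrix.smul_mul, trace_pauli_mul_self, Matrix.trace_one]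
      simp
      ring
    rw [hval] at hpos
    have hpos' : 0 ≤ 2 - 6 * c * p := by exact_mod_cast hpos
    nlinarith
  · intro hp
    have hpsq : 3 * p ^ 2 ≤ 1 := by
      have h := pow_le_pow_left₀ hp0 hp 2
      rw [inv_pow, h3sq] at h
      linarith
    refine ⟨fun b => (1 / 8 : ℝ) • blochMatrix fun x => p * (-1) ^ (b x : ℕ), fun b => ?_, ?_, ?_⟩
    · refine (blochMatrix_posSemidef ?_).smul (by norm_num)
      have h (x : Fin 3) : (p * (-1) ^ (b x : ℕ)) ^ 2 = p ^ 2 := by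
        rw [mul_pow, ← pow_mul, mul_comm _ 2, pow_mul]
        simp
      simpa [h] using hpsq
    · rw [sum_bits_three]
      ext i j
      fin_cases i <;> fin_cases j <;> simp [blochMatrix_eq] <;> ring
    · intro x a
      rw [Finset.sum_filter, sum_bits_three]
      ext i j
      fin_cases x <;> fin_cases a <;> fin_cases i <;> fin_cases j <;>
        simp [blochMatrix_eq, σx, σy, σz] <;> ring
end
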